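/- Let n ≥ 1 and define w_1 = 1^{4n}, w_2 = 1^{2n}0^{2n}, w_3 = 1^n0^n1^n0^n in {0,1}^{4n}. For x ∈ {0,1}^{4n} and j ∈ {1,2,3}, set T_j(x) = (1/(4n))·Σ_{i=1}^{4n} (−1)^{(w_j)_i + x_i}. Then for every x in the domain of f_5, f_5(x) = T_1(x)² + T_2(x)² + T_3(x)². In particular: T_1(x)² + T_2(x)² + T_3(x)² = 1 for each of the six strings x ∈ {0^{4n}, 1^{4n}, 0^{2n}1^{2n}, 1^{2n}0^{2n}, 0^n1^n0^n1^n, 1^n0^n1^n0^n}, and T_1(y) = T_2(y) = T_3(y) = 0 for every y with |y| = 2n, Σ_{i=1}^{2n} y_i = n, and Σ_{i=1}^n y_i + Σ_{i=2n+1}^{3n} y_i = n. -/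

import Mathlib

/-- The Hamming weight of a Boolean string. -/
def wt {n : ℕ} (x : Fin n → Bool) : ℕ := (Finset.univ.filter (fun i => x i)).card

/-- The six strings `0^{4n}, 1^{4n}, 0^{2n}1^{2n}, 1^{2n}0^{2n}, 0^n1^n0^n1^n, 1^n0^n1^n0^n`
on which `f₅` takes value 1 (positions are 0-based). -/
def f5Ones (n : ℕ) : Set (Fin (4 * n) → Bool) :=
  {fun _ => false, fun _ => true,
   fun i => decide (2 * n ≤ i.val), fun i => decide (i.val < 2 * n),
   fun i => decide (i.val / n % 2 = 1), fun i => decide (i.val / n % 2 = 0)}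

/-- The condition defining the strings on which `f₅` takes value 0. -/
def f5ZeroCond (n : ℕ) (y : Fin (4 * n) → Bool) : Prop :=
  wt y = 2 * n ∧
  (Finset.univ.filter (fun i : Fin (4 * n) => y i ∧ i.val < 2 * n)).card = n ∧
  (Finset.univ.filter
    (fun i : Fin (4 * n) => y i ∧ (i.val < n ∨ (2 * n ≤ i.val ∧ i.val < 3 * n)))).card = n

/-- `w₁ = 1^{4n}`. -/
def w1 (n : ℕ) : Fin (4 * n) → Bool := fun _ => true

/-- `w₂ = 1^{2n}0^{2n}`. -/
def w2 (n : ℕ) : Fin (4 * n) → Bool := fun i => decide (i.val < 2 * n)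

/-- `w₃ = 1^n0^n1^n0^n`. -/
def w3 (n : ℕ) : Fin (4 * n) → Bool := fun i => decide (i.val / n % 2 = 0)

/-- `T_j(x) = (1/(4n))·Σ_i (−1)^{(w_j)_i + x_i}`. -/
noncomputable def Tsum (n : ℕ) (w x : Fin (4 * n) → Bool) : ℝ :=
  (1 / (4 * (n : ℝ))) *
    ∑ i, (if w i then (-1 : ℝ) else 1) * (if x i then (-1 : ℝ) else 1)

/-- The sum of a function that is constant on each of the four consecutive blocks of length `n`. -/
theorem sum_blocks (n : ℕ) (c : ℕ → ℝ) :
    ∑ i : Fin (4 * n), c (i.val / n) = n * (c 0 + c 1 + c 2 + c 3) := by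
  have block : ∀ (b : Fin 4) (j : Fin n), c ((finProdFinEquiv (b, j)).val / n) = c b := by
    intro b j
    have hn : 0 < n := j.pos
    congr 1
    simp [finProdFinEquiv, Nat.add_mul_div_left _ _ hn, Nat.div_eq_of_lt j.isLt]
  rw [← finProdFinEquiv.sum_comp, Fintype.sum_prod_type]
  simp only [block, Fin.sum_univ_four, Finset.sum_const, Finset.card_univ, Fintype.card_fin,
    nsmul_eq_mul]
  simp
  ring

/-- The sign sum of two strings in terms of the sign sum of `w`, the weight of `y`, and the size of
the intersection of their supports. -/
theorem sum_sign_mul_sign {m : ℕ} (w y : Fin m → Bool) :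
    ∑ i, (if w i then (-1 : ℝ) else 1) * (if y i then (-1 : ℝ) else 1) =
      ∑ i, (if w i then (-1 : ℝ) else 1) - 2 * (wt y : ℝ) +
        4 * ((Finset.univ.filter (fun i => y i ∧ w i)).card : ℝ) := by
  simp only [wt, Finset.card_filter, Nat.cast_sum, Finset.mul_sum, ← Finset.sum_sub_distrib,
    ← Finset.sum_add_distrib]
  refine Finset.sum_congr rfl fun i _ => ?_
  cases w i <;> cases y i <;> norm_num

theorem lt_two_mul_iff_div {n : ℕ} (hn : 1 ≤ n) (i : ℕ) : i < 2 * n ↔ i / n < 2 :=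
  (Nat.div_lt_iff_lt_mul hn).symm

theorem two_mul_le_iff_div {n : ℕ} (hn : 1 ≤ n) (i : ℕ) : 2 * n ≤ i ↔ 2 ≤ i / n :=
  (Nat.le_div_iff_mul_le hn).symm

theorem div_mod_two_eq_zero_iff {n : ℕ} (hn : 1 ≤ n) (i : Fin (4 * n)) :
    i.val / n % 2 = 0 ↔ i.val < n ∨ (2 * n ≤ i.val ∧ i.val < 3 * n) := by
  have h1 : i.val / n < 1 ↔ i.val < 1 * n := Nat.div_lt_iff_lt_mul hn
  have h2 : 2 ≤ i.val / n ↔ 2 * n ≤ i.val := Nat.le_div_iff_mul_le hn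
  have h3 : i.val / n < 3 ↔ i.val < 3 * n := Nat.div_lt_iff_lt_mul hn
  have h4 : i.val / n < 4 := (Nat.div_lt_iff_lt_mul hn).2 i.isLt
  generalize i.val / n = q at *
  omega

theorem Tsum_of_blocks {n : ℕ} (hn : 1 ≤ n) {w x : Fin (4 * n) → Bool} (a b : ℕ → Bool)
    (hw : ∀ i, w i = a (i.val / n)) (hx : ∀ i, x i = b (i.val / n)) :
    Tsum n w x = ((if a 0 then (-1 : ℝ) else 1) * (if b 0 then (-1 : ℝ) else 1) +
      (if a 1 then (-1 : ℝ) else 1) * (if b 1 then (-1 : ℝ) else 1) +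
      (if a 2 then (-1 : ℝ) else 1) * (if b 2 then (-1 : ℝ) else 1) +
      (if a 3 then (-1 : ℝ) else 1) * (if b 3 then (-1 : ℝ) else 1)) / 4 := by
  have hn' : (n : ℝ) ≠ 0 := by positivity
  simp only [Tsum, hw, hx]
  rw [sum_blocks n fun k =>
    (if a k then (-1 : ℝ) else 1) * (if b k then (-1 : ℝ) else 1)]
  field_simp

theorem w2_eq_block {n : ℕ} (hn : 1 ≤ n) (i : Fin (4 * n)) :
    w2 n i = decide (i.val / n < 2) := by
  simp [w2, lt_two_mul_iff_div hn]

theorem sum_sq_Tsum_of_blocks {n : ℕ} (hn : 1 ≤ n) {x : Fin (4 * n) → Bool} (b : ℕ → Bool)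
    (hx : ∀ i, x i = b (i.val / n))
    (hb : (b 0 = b 1 ∧ b 2 = b 3) ∨ (b 0 = b 2 ∧ b 1 = b 3)) :
    Tsum n (w1 n) x ^ 2 + Tsum n (w2 n) x ^ 2 + Tsum n (w3 n) x ^ 2 = 1 := by
  rw [Tsum_of_blocks (w := w1 n) hn (fun _ => true) b (fun _ => rfl) hx,
    Tsum_of_blocks hn (fun k => decide (k < 2)) b (w2_eq_block hn) hx,
    Tsum_of_blocks (w := w3 n) hn (fun k => decide (k % 2 = 0)) b (fun _ => rfl) hx]
  generalize b 0 = b0, b 1 = b1, b 2 = b2, b 3 = b3 at *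
  rcases hb with ⟨rfl, rfl⟩ | ⟨rfl, rfl⟩
  · cases b0 <;> cases b2 <;> norm_num
  · cases b0 <;> cases b1 <;> norm_num

theorem Tsum_eq_zero_of_blocks {n : ℕ} {w y : Fin (4 * n) → Bool} (a : ℕ → Bool)
    (hw : ∀ i, w i = a (i.val / n))
    (ha : ∑ k ∈ Finset.range 4, (if a k then (-1 : ℝ) else 1) = 0)
    (hy : wt y = 2 * n) (hwy : (Finset.univ.filter (fun i => y i ∧ w i)).card = n) :
    Tsum n w y = 0 := by
  have hsum : ∑ i, (if w i then (-1 : ℝ) else 1) = 0 := by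
    simp only [hw]
    rw [sum_blocks n fun k => if a k then (-1 : ℝ) else 1]
    simp only [Finset.sum_range_succ, Finset.sum_range_zero, zero_add] at ha
    rw [ha, mul_zero]
  rw [Tsum, sum_sign_mul_sign, hsum, hy, hwy]
  push_cast
  ring

theorem stmt14 (n : ℕ) (hn : 1 ≤ n) :
    (∀ x ∈ f5Ones n,
      Tsum n (w1 n) x ^ 2 + Tsum n (w2 n) x ^ 2 + Tsum n (w3 n) x ^ 2 = 1) ∧
    (∀ y : Fin (4 * n) → Bool, f5ZeroCond n y →
      Tsum n (w1 n) y = 0 ∧ Tsum n (w2 n) y = 0 ∧ Tsum n (w3 n) y = 0) := by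
  refine ⟨fun x hx => ?_, fun y ⟨hwt, hhalf, hquarter⟩ => ⟨?_, ?_, ?_⟩⟩
  · simp only [f5Ones, Set.mem_insert_iff, Set.mem_singleton_iff] at hx
    rcases hx with rfl | rfl | rfl | rfl | rfl | rfl
    · exact sum_sq_Tsum_of_blocks hn (fun _ => false) (fun _ => rfl) (by decide)
    · exact sum_sq_Tsum_of_blocks hn (fun _ => true) (fun _ => rfl) (by decide)
    · exact sum_sq_Tsum_of_blocks hn (fun k => decide (2 ≤ k))
        (fun i => by simp only [two_mul_le_iff_div hn]) (by decide)
    · exact sum_sq_Tsum_of_blocks hn (fun k => decide (k < 2)) (w2_eq_block hn) (by decide)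
    · exact sum_sq_Tsum_of_blocks hn (fun k => decide (k % 2 = 1)) (fun _ => rfl) (by decide)
    · exact sum_sq_Tsum_of_blocks hn (fun k => decide (k % 2 = 0)) (fun _ => rfl) (by decide)
  · have hinter : (Finset.univ.filter (fun i => y i ∧ w1 n i)).card = 2 * n := by
      simpa [w1, wt] using hwt
    rw [Tsum, sum_sign_mul_sign, hinter, hwt]
    simp [w1]
    right
    ring
  · refine Tsum_eq_zero_of_blocks (fun k => decide (k < 2)) (w2_eq_block hn) ?_ hwt ?_
    · norm_num [Finset.sum_range_succ]
    · simpa only [w2, decide_eq_true_eq] using hhalf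
  · refine Tsum_eq_zero_of_blocks (fun k => decide (k % 2 = 0)) (fun _ => rfl) ?_ hwt ?_
    · norm_num [Finset.sum_range_succ]
    · simpa only [w3, decide_eq_true_eq, div_mod_two_eq_zero_iff hn] using hquarter
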